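/- Let n ≥ 2 and let (Z_1,…,Z_n) be a centered Gaussian vector with E[Z_i²] = 1 for every i. Then for all q_1,…,q_n ∈ ℕ: E[∏_{r=1}^n H_{q_r}(Z_r)] = (∏_{r=1}^n q_r!) · Σ_{κ = {k_{ij}} ∈ A_{q_1,…,q_n}} ∏_{1 ≤ i < j ≤ n} E[Z_i Z_j]^{k_{ij}} / k_{ij}!. -/

import Mathlib

open MeasureTheory ProbabilityTheory Polynomial

noncomputable section

/-- Evaluation of the probabilists' Hermite polynomial `H_q`. -/
def Hval (q : ℕ) (z : ℝ) : ℝ := Polynomial.aeval z (Polynomial.hermite q)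

/-- The index set `A_{q₁,…,qₙ}` of the diagram formula: symmetric families of
nonnegative integers `k i j` with zero diagonal and row sums `q i`. -/
def memA {n : ℕ} (q : Fin n → ℕ) (k : Fin n → Fin n → ℕ) : Prop :=
  (∀ i, k i i = 0) ∧ (∀ i j, k i j = k j i) ∧ (∀ i, (∑ j, k i j) = q i)

/-- The derivative of the probabilists' Hermite polynomials lowers the degree. -/
lemma derivative_hermite (m : ℕ) :
    derivative (hermite m) = (m : ℤ[X]) * hermite (m - 1) := by
  induction m with
  | zero => simp
  | succ m ih =>
    rw [hermite_succ, derivative_sub, derivative_mul, ih]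
    cases m with
    | zero => simp
    | succ m =>
      have h := hermite_succ m
      simp only [derivative_X, derivative_mul, derivative_natCast, Nat.add_sub_cancel] at ih ⊢
      push_cast
      rw [h]
      ring

/-- The vector `t` with its coordinate `k` shifted by `s`. -/
def shiftCoord {ι : Type*} [DecidableEq ι] (t : ι → ℝ) (k : ι) (s : ℝ) : ι → ℝ :=
  fun i => t i + s * (if i = k then 1 else 0)

@[simp]
lemma shiftCoord_zero {ι : Type*} [DecidableEq ι] (t : ι → ℝ) (k : ι) : shiftCoord t k 0 = t := by
  ext i
  simp [shiftCoord]

lemma sum_shiftCoord_mul {ι : Type*} [Fintype ι] [DecidableEq ι] (t z : ι → ℝ) (k : ι)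
    (s : ℝ) :
    ∑ i, shiftCoord t k s i * z i = ∑ i, t i * z i + s * z k := by
  simp [shiftCoord, add_mul, Finset.sum_add_distrib]

lemma exp_mul_le_exp_add_exp_neg {s : ℝ} (hs : |s| ≤ 1) (x : ℝ) :
    Real.exp (s * x) ≤ Real.exp x + Real.exp (-x) := by
  have h : s * x ≤ |x| := by
    calc s * x ≤ |s * x| := le_abs_self _
      _ = |s| * |x| := abs_mul _ _
      _ ≤ 1 * |x| := by gcongr
      _ = |x| := one_mul _
  refine (Real.exp_le_exp.mpr h).trans ?_
  have h1 := Real.exp_pos x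
  have h2 := Real.exp_pos (-x)
  rcases abs_cases x with ⟨h, _⟩ | ⟨h, _⟩ <;> rw [h] <;> linarith

lemma abs_le_exp_add_exp_neg (x : ℝ) : |x| ≤ Real.exp x + Real.exp (-x) := by
  have h1 := Real.add_one_le_exp x
  have h2 := Real.add_one_le_exp (-x)
  have h3 := Real.exp_pos x
  have h4 := Real.exp_pos (-x)
  rcases abs_cases x with ⟨h, _⟩ | ⟨h, _⟩ <;> rw [h] <;> linarith

section Stein

variable {ι Ω : Type*} [Fintype ι] {mΩ : MeasurableSpace Ω} {μ : Measure Ω} {Z : ι → Ω → ℝ}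

lemma aestronglyMeasurable_eval_mul_exp (hZ : ∀ i, AEMeasurable (Z i) μ)
    (p : MvPolynomial ι ℝ) (t : ι → ℝ) :
    AEStronglyMeasurable
      (fun ω => MvPolynomial.eval (fun i => Z i ω) p * Real.exp (∑ i, t i * Z i ω)) μ := by
  have hZ' : AEMeasurable (fun ω i => Z i ω) μ := aemeasurable_pi_iff.mpr hZ
  have hp : Continuous fun z : ι → ℝ =>
      MvPolynomial.eval z p * Real.exp (∑ i, t i * z i) :=
    (MvPolynomial.continuous_eval p).mul (by fun_prop)
  exact (hp.measurable.comp_aemeasurable hZ').aestronglyMeasurable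

/-- If all exponential moments are finite, then polynomials times exponentials are integrable. -/
lemma integrable_eval_mul_exp (hZ : ∀ i, AEMeasurable (Z i) μ)
    (hexp : ∀ t : ι → ℝ, Integrable (fun ω => Real.exp (∑ i, t i * Z i ω)) μ)
    (p : MvPolynomial ι ℝ) (t : ι → ℝ) :
    Integrable
      (fun ω => MvPolynomial.eval (fun i => Z i ω) p * Real.exp (∑ i, t i * Z i ω)) μ := by
  classical
  induction p using MvPolynomial.induction_on generalizing t with
  | C a => simpa using (hexp t).const_mul a
  | add p q hp hq =>
    simp only [map_add, add_mul]
    exact (hp t).add (hq t)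
  | mul_X p k hp =>
    refine ((hp (shiftCoord t k 1)).abs.add
      (hp (shiftCoord t k (-1))).abs).mono'
      (aestronglyMeasurable_eval_mul_exp hZ _ _) (ae_of_all _ fun ω => ?_)
    simp only [Pi.add_apply, sum_shiftCoord_mul t (fun i => Z i ω), one_mul, neg_one_mul,
      Real.exp_add, map_mul, MvPolynomial.eval_X, Real.norm_eq_abs, abs_mul, Real.abs_exp]
    have := mul_le_mul_of_nonneg_left (abs_le_exp_add_exp_neg (Z k ω))
      (show 0 ≤ |MvPolynomial.eval (fun i => Z i ω) p| * Real.exp (∑ i, t i * Z i ω) by positivity)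
    linarith

/-- Differentiation under the integral sign for polynomials times exponentials. -/
lemma hasDerivAt_integral_eval_mul_exp [DecidableEq ι] (hZ : ∀ i, AEMeasurable (Z i) μ)
    (hexp : ∀ t : ι → ℝ, Integrable (fun ω => Real.exp (∑ i, t i * Z i ω)) μ)
    (p : MvPolynomial ι ℝ) (t : ι → ℝ) (k : ι) :
    HasDerivAt
      (fun s : ℝ => ∫ ω, MvPolynomial.eval (fun i => Z i ω) p *
        Real.exp (∑ i, shiftCoord t k s i * Z i ω) ∂μ)
      (∫ ω, MvPolynomial.eval (fun i => Z i ω) (MvPolynomial.X k * p) *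
        Real.exp (∑ i, t i * Z i ω) ∂μ) 0 := by
  have key := hasDerivAt_integral_of_dominated_loc_of_deriv_le (μ := μ) (𝕜 := ℝ)
    (F := fun s ω => MvPolynomial.eval (fun i => Z i ω) p *
        Real.exp (∑ i, shiftCoord t k s i * Z i ω))
    (F' := fun s ω => MvPolynomial.eval (fun i => Z i ω) (MvPolynomial.X k * p) *
        Real.exp (∑ i, shiftCoord t k s i * Z i ω))
    (x₀ := 0) (s := Metric.ball 0 1)
    (bound := fun ω =>
      |MvPolynomial.eval (fun i => Z i ω) (MvPolynomial.X k * p) *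
        Real.exp (∑ i, shiftCoord t k 1 i * Z i ω)| +
      |MvPolynomial.eval (fun i => Z i ω) (MvPolynomial.X k * p) *
        Real.exp (∑ i, shiftCoord t k (-1) i * Z i ω)|)
    (Metric.ball_mem_nhds _ one_pos)
    (Filter.Eventually.of_forall fun s => aestronglyMeasurable_eval_mul_exp hZ _ _)
    (integrable_eval_mul_exp hZ hexp p (shiftCoord t k 0))
    (aestronglyMeasurable_eval_mul_exp hZ (MvPolynomial.X k * p) (shiftCoord t k 0))
    (ae_of_all _ fun ω s hs => ?_)
    ((integrable_eval_mul_exp hZ hexp (MvPolynomial.X k * p) (shiftCoord t k 1)).abs.add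
      (integrable_eval_mul_exp hZ hexp (MvPolynomial.X k * p) (shiftCoord t k (-1))).abs)
    (ae_of_all _ fun ω s _ => ?_)
  · simpa using key.2
  · have hs' : |s| ≤ 1 := by
      rw [Metric.mem_ball, dist_zero_right, Real.norm_eq_abs] at hs
      exact hs.le
    simp only [sum_shiftCoord_mul t (fun i => Z i ω), one_mul, neg_one_mul,
      Real.exp_add, Real.norm_eq_abs, abs_mul, Real.abs_exp]
    have := mul_le_mul_of_nonneg_left (exp_mul_le_exp_add_exp_neg hs' (Z k ω))
      (show 0 ≤ |MvPolynomial.eval (fun i => Z i ω) (MvPolynomial.X k * p)| *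
        Real.exp (∑ i, t i * Z i ω) by positivity)
    linarith
  · simp only [sum_shiftCoord_mul t (fun i => Z i ω), map_mul, MvPolynomial.eval_X]
    have h : HasDerivAt (fun s : ℝ => ∑ i, t i * Z i ω + s * Z k ω) (Z k ω) s := by
      simpa using ((hasDerivAt_id s).mul_const (Z k ω)).const_add (∑ i, t i * Z i ω)
    refine (h.exp.const_mul (MvPolynomial.eval (fun i => Z i ω) p)).congr_deriv ?_
    ring

/-- Gaussian integration by parts, with an exponential weight. -/
lemma integral_X_mul_eval_mul_exp (hZ : ∀ i, AEMeasurable (Z i) μ)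
    (hexp : ∀ t : ι → ℝ, Integrable (fun ω => Real.exp (∑ i, t i * Z i ω)) μ)
    {S : ι → ι → ℝ} (hS : ∀ i j, S i j = S j i)
    (hmgf : ∀ t : ι → ℝ, ∫ ω, Real.exp (∑ i, t i * Z i ω) ∂μ =
      Real.exp ((∑ i, ∑ j, t i * t j * S i j) / 2))
    (i : ι) (p : MvPolynomial ι ℝ) (t : ι → ℝ) :
    ∫ ω, MvPolynomial.eval (fun i => Z i ω) (MvPolynomial.X i * p) *
        Real.exp (∑ i, t i * Z i ω) ∂μ =
      ∑ j, S i j * (∫ ω, MvPolynomial.eval (fun i => Z i ω) (MvPolynomial.pderiv j p) *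
          Real.exp (∑ i, t i * Z i ω) ∂μ +
        t j * ∫ ω, MvPolynomial.eval (fun i => Z i ω) p * Real.exp (∑ i, t i * Z i ω) ∂μ) := by
  classical
  induction p using MvPolynomial.induction_on generalizing t with
  | C a =>
    have h1 := hasDerivAt_integral_eval_mul_exp hZ hexp (MvPolynomial.C a) t i
    have hquad : ∀ s : ℝ, ∑ k, ∑ j, shiftCoord t i s k *
        shiftCoord t i s j * S k j =
        ∑ k, ∑ j, t k * t j * S k j + s * (2 * ∑ j, S i j * t j) + s ^ 2 * S i i := by
      intro s
      have e1 : ∀ k j, shiftCoord t i s k *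
          shiftCoord t i s j * S k j = t k * t j * S k j
          + s * (t k * S k j * (if j = i then 1 else 0)) + s * (t j * S k j * (if k = i then 1 else 0))
          + s ^ 2 * (S k j * (if j = i then 1 else 0) * (if k = i then 1 else 0)) := by
        intro k j
        simp only [shiftCoord]
        ring
      simp only [e1, Finset.sum_add_distrib, ← Finset.mul_sum]
      simp only [mul_ite, mul_one, mul_zero, Finset.sum_ite_eq',
        Finset.mem_univ, if_true, Finset.sum_ite_irrel, Finset.sum_const_zero]
      have e2 : ∑ k, t k * S k i = ∑ j, S i j * t j :=
        Finset.sum_congr rfl fun k _ => by rw [hS k i, mul_comm]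
      have e3 : ∑ k, t k * S i k = ∑ j, S i j * t j :=
        Finset.sum_congr rfl fun k _ => mul_comm _ _
      rw [e2, e3]
      ring
    have h2 : HasDerivAt (fun s : ℝ => a * Real.exp ((∑ k, ∑ j, t k * t j * S k j +
        s * (2 * ∑ j, S i j * t j) + s ^ 2 * S i i) / 2))
        (a * (Real.exp ((∑ k, ∑ j, t k * t j * S k j) / 2) * ∑ j, S i j * t j)) 0 := by
      have h3 := (((((hasDerivAt_id (0 : ℝ)).mul_const (2 * ∑ j, S i j * t j)).const_add
        (∑ k, ∑ j, t k * t j * S k j)).add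
        (((hasDerivAt_id (0 : ℝ)).pow 2).mul_const (S i i))).div_const 2).exp.const_mul a
      refine h3.congr_deriv ?_
      simp
    simp only [MvPolynomial.eval_C, integral_const_mul, hmgf, hquad] at h1
    rw [h1.unique h2]
    simp only [MvPolynomial.pderiv_C, map_zero, zero_mul, integral_zero, zero_add,
      MvPolynomial.eval_C, integral_const_mul, hmgf, Finset.mul_sum]
    exact Finset.sum_congr rfl fun j _ => by ring
  | add p q hp hq =>
    have hi := integrable_eval_mul_exp hZ hexp
    simp only [mul_add, map_add, add_mul] at hp hq ⊢
    rw [integral_add (hi _ _) (hi _ _), hp, hq, ← Finset.sum_add_distrib]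
    refine Finset.sum_congr rfl fun j _ => ?_
    rw [integral_add (hi _ _) (hi _ _), integral_add (hi _ _) (hi _ _)]
    ring
  | mul_X p k hp =>
    have hd := fun r => hasDerivAt_integral_eval_mul_exp hZ hexp r t k
    have h1 := hd (MvPolynomial.X i * p)
    simp only [hp] at h1
    have h2 : HasDerivAt (fun s : ℝ => ∑ j, S i j *
        (∫ ω, MvPolynomial.eval (fun i => Z i ω) (MvPolynomial.pderiv j p) *
          Real.exp (∑ i, shiftCoord t k s i * Z i ω) ∂μ +
        shiftCoord t k s j * ∫ ω, MvPolynomial.eval (fun i => Z i ω) p *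
          Real.exp (∑ i, shiftCoord t k s i * Z i ω) ∂μ))
        (∑ j, S i j *
        (∫ ω, MvPolynomial.eval (fun i => Z i ω) (MvPolynomial.X k * MvPolynomial.pderiv j p) *
          Real.exp (∑ i, t i * Z i ω) ∂μ +
        ((if j = k then 1 else 0) * ∫ ω, MvPolynomial.eval (fun i => Z i ω) p *
          Real.exp (∑ i, t i * Z i ω) ∂μ +
        t j * ∫ ω, MvPolynomial.eval (fun i => Z i ω) (MvPolynomial.X k * p) *
          Real.exp (∑ i, t i * Z i ω) ∂μ))) 0 := by
      refine HasDerivAt.fun_sum fun j _ => HasDerivAt.const_mul _ ((hd _).add ?_)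
      have h3 : HasDerivAt (fun s : ℝ => shiftCoord t k s j)
          (if j = k then 1 else 0) 0 := by
        simpa [shiftCoord] using ((hasDerivAt_id (0 : ℝ)).mul_const (if j = k then 1 else 0)).const_add (t j)
      simpa using h3.fun_mul (hd p)
    have h4 := h1.unique h2
    rw [show MvPolynomial.X i * (p * MvPolynomial.X k) =
      MvPolynomial.X k * (MvPolynomial.X i * p) by ring, h4]
    refine Finset.sum_congr rfl fun j _ => ?_
    congr 1
    rw [← add_assoc, mul_comm p (MvPolynomial.X k)]
    congr 1
    have hi := integrable_eval_mul_exp hZ hexp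
    rw [← integral_const_mul, ← integral_add (hi _ _) ((hi _ _).const_mul _)]
    congr 1
    ext ω
    simp only [MvPolynomial.pderiv_mul, MvPolynomial.pderiv_X, map_add, map_mul,
      MvPolynomial.eval_X]
    by_cases hjk : j = k
    · subst hjk
      simp
      ring
    · simp [hjk, Ne.symm hjk]

end Stein

section Diagrams

variable {n : ℕ}

/-- The family with a single edge joining `i` and `j`. -/
def edge (i j : Fin n) : Fin n → Fin n → ℕ := fun a b =>
  (Pi.single i 1 : Fin n → ℕ) a * (Pi.single j 1 : Fin n → ℕ) b +
    (Pi.single j 1 : Fin n → ℕ) a * (Pi.single i 1 : Fin n → ℕ) b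

lemma edge_comm (i j : Fin n) : edge i j = edge j i := by
  funext a b
  exact add_comm _ _

lemma edge_symm (i j a b : Fin n) : edge i j a b = edge i j b a := by
  simp only [edge]
  ring

lemma edge_self {i j : Fin n} (hij : i ≠ j) (a : Fin n) : edge i j a a = 0 := by
  by_cases h : a = i
  · subst h
    simp [edge, hij]
  · simp [edge, h]

lemma edge_apply {i j : Fin n} (hij : i ≠ j) : edge i j i j = 1 := by
  simp [edge, hij]

lemma edge_eq_zero_of_lt {i j a b : Fin n} (hij : i < j) (hab : a < b)
    (h : ¬(a = i ∧ b = j)) : edge i j a b = 0 := by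
  by_cases h1 : a = i
  · have h2 : b ≠ j := fun h2 => h ⟨h1, h2⟩
    have h3 : a ≠ j := by omega
    simp [edge, h2, h3]
  · by_cases h2 : a = j
    · have h3 : b ≠ i := by omega
      simp [edge, h1, h3]
    · simp [edge, h1, h2]

lemma sum_edge (i j a : Fin n) :
    ∑ b, edge i j a b = (Pi.single i 1 + Pi.single j 1 : Fin n → ℕ) a := by
  simp [edge, Finset.sum_add_distrib, ← Finset.mul_sum]

lemma memA_add_edge_iff {i j : Fin n} (hij : i ≠ j) (q : Fin n → ℕ) (k : Fin n → Fin n → ℕ) :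
    memA (q + Pi.single i 1 + Pi.single j 1) (k + edge i j) ↔ memA q k := by
  simp only [memA, Pi.add_apply, edge_self hij, add_zero, Finset.sum_add_distrib, sum_edge,
    add_assoc, add_left_inj]
  refine and_congr_right fun _ => and_congr_left fun _ => forall_congr' fun a =>
    forall_congr' fun b => ?_
  rw [edge_symm i j a b, add_left_inj]

lemma finite_memA (q : Fin n → ℕ) : {k | memA q k}.Finite := by
  refine (Set.finite_Icc (0 : Fin n → Fin n → ℕ) fun i _ => q i).subset fun k hk => ?_
  refine ⟨fun _ _ => Nat.zero_le _, fun i j => ?_⟩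
  refine le_of_le_of_eq ?_ (hk.2.2 i)
  exact Finset.single_le_sum (f := k i) (fun _ _ => Nat.zero_le _) (Finset.mem_univ j)

/-- The finite set `A_{q₁,…,qₙ}`. -/
def diagrams (q : Fin n → ℕ) : Finset (Fin n → Fin n → ℕ) := (finite_memA q).toFinset

lemma mem_diagrams {q : Fin n → ℕ} {k : Fin n → Fin n → ℕ} : k ∈ diagrams q ↔ memA q k := by
  simp [diagrams]

/-- The contribution of a single family to the diagram formula. -/
def diagramWeight (C : Fin n → Fin n → ℝ) (k : Fin n → Fin n → ℕ) : ℝ :=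
  ∏ p ∈ Finset.univ.filter (fun p : Fin n × Fin n => p.1 < p.2),
    C p.1 p.2 ^ (k p.1 p.2) / (Nat.factorial (k p.1 p.2) : ℝ)

lemma tsum_memA (C : Fin n → Fin n → ℝ) (q : Fin n → ℕ) :
    ∑' κ : {k : Fin n → Fin n → ℕ // memA q k}, diagramWeight C κ.1 =
      ∑ k ∈ diagrams q, diagramWeight C k := by
  have h : {k | memA q k} = (diagrams q : Set (Fin n → Fin n → ℕ)) := by
    ext k
    simp [mem_diagrams]
  exact (tsum_subtype {k | memA q k} (diagramWeight C)).trans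
    (by rw [h, ← tsum_subtype, Finset.tsum_subtype'])

lemma diagramWeight_add_edge_of_lt (C : Fin n → Fin n → ℝ) {i j : Fin n} (hij : i < j)
    (k : Fin n → Fin n → ℕ) :
    ((k i j + 1 : ℕ) : ℝ) * diagramWeight C (k + edge i j) = C i j * diagramWeight C k := by
  have hmem : (i, j) ∈ Finset.univ.filter (fun p : Fin n × Fin n => p.1 < p.2) := by
    simpa using hij
  unfold diagramWeight
  rw [← Finset.mul_prod_erase _ _ hmem, ← Finset.mul_prod_erase _ _ hmem]
  have hrest : ∀ p ∈ (Finset.univ.filter (fun p : Fin n × Fin n => p.1 < p.2)).erase (i, j),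
      C p.1 p.2 ^ ((k + edge i j) p.1 p.2) / (Nat.factorial ((k + edge i j) p.1 p.2) : ℝ) =
      C p.1 p.2 ^ (k p.1 p.2) / (Nat.factorial (k p.1 p.2) : ℝ) := by
    rintro ⟨a, b⟩ hp
    simp only [Finset.mem_erase, Finset.mem_filter, Finset.mem_univ, true_and, ne_eq,
      Prod.mk.injEq] at hp
    simp [edge_eq_zero_of_lt hij hp.2 hp.1]
  rw [Finset.prod_congr rfl hrest]
  simp only [Pi.add_apply, edge_apply hij.ne, Nat.factorial_succ, pow_succ, Nat.cast_mul]
  have h1 : ((k i j + 1 : ℕ) : ℝ) ≠ 0 := by positivity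
  have h2 : (Nat.factorial (k i j) : ℝ) ≠ 0 := by positivity
  field_simp

lemma diagramWeight_add_edge {C : Fin n → Fin n → ℝ} (hC : ∀ i j, C i j = C j i) {i j : Fin n}
    (hij : i ≠ j) {k : Fin n → Fin n → ℕ} (hk : k i j = k j i) :
    ((k i j + 1 : ℕ) : ℝ) * diagramWeight C (k + edge i j) = C i j * diagramWeight C k := by
  rcases lt_or_gt_of_ne hij with h | h
  · exact diagramWeight_add_edge_of_lt C h k
  · rw [hk, hC, edge_comm]
    exact diagramWeight_add_edge_of_lt C h k

/-- Removing an edge between `i` and `j`. -/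
lemma sum_diagrams_mul_weight {C : Fin n → Fin n → ℝ} (hC : ∀ i j, C i j = C j i) {i j : Fin n}
    (hij : i ≠ j) (q : Fin n → ℕ) :
    ∑ k ∈ diagrams (q + Pi.single i 1 + Pi.single j 1), (k i j : ℝ) * diagramWeight C k =
      C i j * ∑ k ∈ diagrams q, diagramWeight C k := by
  rw [Finset.mul_sum]
  symm
  refine Finset.sum_of_injOn (fun k => k + edge i j) (fun _ _ _ _ h => add_right_cancel h)
    (fun k hk => ?_) (fun k hk hk' => ?_) (fun k hk => ?_)
  · simp only [Finset.mem_coe, mem_diagrams] at hk ⊢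
    exact (memA_add_edge_iff hij q k).mpr hk
  · rw [mem_diagrams] at hk
    suffices h : k i j = 0 by simp [h]
    by_contra h
    have hle : edge i j ≤ k := by
      intro a b
      by_cases h1 : a = i ∧ b = j
      · rw [h1.1, h1.2, edge_apply hij]
        exact Nat.one_le_iff_ne_zero.mpr h
      · by_cases h2 : a = j ∧ b = i
        · rw [h2.1, h2.2, edge_symm, edge_apply hij, hk.2.1]
          exact Nat.one_le_iff_ne_zero.mpr h
        · have : edge i j a b = 0 := by
            simp only [edge, Pi.single_apply]
            split_ifs <;> simp_all
          rw [this]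
          exact Nat.zero_le _
    refine hk' ⟨k - edge i j, ?_, tsub_add_cancel_of_le hle⟩
    rw [Finset.mem_coe, mem_diagrams, ← memA_add_edge_iff hij, tsub_add_cancel_of_le hle]
    exact hk
  · rw [mem_diagrams] at hk
    rw [← diagramWeight_add_edge hC hij (hk.2.1 i j)]
    simp [edge_apply hij]

/-- The right-hand side of the diagram formula. -/
def diagramSum (C : Fin n → Fin n → ℝ) (q : Fin n → ℕ) : ℝ :=
  (∏ r, (Nat.factorial (q r) : ℝ)) * ∑ k ∈ diagrams q, diagramWeight C k

lemma diagramSum_zero (C : Fin n → Fin n → ℝ) : diagramSum C 0 = 1 := by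
  have h : diagrams (0 : Fin n → ℕ) = {0} := by
    ext k
    rw [mem_diagrams, Finset.mem_singleton]
    constructor
    · intro hk
      funext i j
      exact Finset.sum_eq_zero_iff.mp (hk.2.2 i) j (Finset.mem_univ j)
    · rintro rfl
      simp [memA]
  simp [diagramSum, h, diagramWeight]

lemma prod_factorial_add_single (q : Fin n → ℕ) (i : Fin n) :
    ∏ r, (Nat.factorial ((q + Pi.single i 1 : Fin n → ℕ) r) : ℝ) =
      (q i + 1) * ∏ r, (Nat.factorial (q r) : ℝ) := by
  rw [← Finset.mul_prod_erase _ _ (Finset.mem_univ i),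
    ← Finset.mul_prod_erase _ (fun r => (Nat.factorial (q r) : ℝ)) (Finset.mem_univ i),
    Finset.prod_congr rfl (g := fun r => (Nat.factorial (q r) : ℝ))]
  · simp [Nat.factorial_succ, mul_assoc]
  · intro r hr
    simp [Finset.ne_of_mem_erase hr]

lemma sub_single_add_single {q : Fin n → ℕ} {j : Fin n} (h : q j ≠ 0) :
    q - Pi.single j 1 + Pi.single j 1 = q := by
  refine tsub_add_cancel_of_le fun a => ?_
  by_cases ha : a = j
  · subst ha
    simpa using Nat.one_le_iff_ne_zero.mpr h
  · simp [ha]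

lemma diagramSum_add_single {C : Fin n → Fin n → ℝ} (hC : ∀ i j, C i j = C j i)
    (q : Fin n → ℕ) (i : Fin n) :
    diagramSum C (q + Pi.single i 1) =
      ∑ j ∈ Finset.univ.erase i, C i j * (q j * diagramSum C (q - Pi.single j 1)) := by
  have h1 : ((q i : ℝ) + 1) * ∑ k ∈ diagrams (q + Pi.single i 1), diagramWeight C k =
      ∑ j, ∑ k ∈ diagrams (q + Pi.single i 1), (k i j : ℝ) * diagramWeight C k := by
    rw [Finset.sum_comm, Finset.mul_sum]
    refine Finset.sum_congr rfl fun k hk => ?_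
    have h := (mem_diagrams.mp hk).2.2 i
    rw [← Finset.sum_mul, ← Nat.cast_sum, h]
    simp
  unfold diagramSum
  rw [prod_factorial_add_single, mul_comm ((q i : ℝ) + 1), mul_assoc, h1,
    ← Finset.add_sum_erase _ _ (Finset.mem_univ i), Finset.sum_eq_zero, zero_add, Finset.mul_sum]
  · refine Finset.sum_congr rfl fun j hj => ?_
    have hij : i ≠ j := (Finset.ne_of_mem_erase hj).symm
    by_cases hq : q j = 0
    · rw [hq, Nat.cast_zero, zero_mul, mul_zero, Finset.sum_eq_zero, mul_zero]
      intro k hk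
      rw [mem_diagrams] at hk
      have h := hk.2.2 j
      rw [Pi.add_apply, hq, Pi.single_eq_of_ne hij.symm] at h
      rw [hk.2.1, Finset.sum_eq_zero_iff.mp h i (Finset.mem_univ i)]
      simp
    · obtain ⟨q, rfl⟩ : ∃ q' : Fin n → ℕ, q = q' + Pi.single j 1 :=
        ⟨_, (sub_single_add_single hq).symm⟩
      rw [add_right_comm, sum_diagrams_mul_weight hC hij, prod_factorial_add_single,
        add_tsub_cancel_right]
      simp
      ring
  · intro k hk
    simp [(mem_diagrams.mp hk).1 i]

end Diagrams

section Hermite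

variable {ι : Type*}

/-- The probabilists' Hermite polynomial in the variable `r`. -/
def hermiteVar (r : ι) (m : ℕ) : MvPolynomial ι ℝ :=
  aeval (MvPolynomial.X r : MvPolynomial ι ℝ) ((hermite m).map (algebraMap ℤ ℝ))

lemma eval_hermiteVar (z : ι → ℝ) (r : ι) (m : ℕ) :
    MvPolynomial.eval z (hermiteVar r m) = Hval m (z r) := by
  have h := Polynomial.aeval_algHom_apply (MvPolynomial.aeval z : MvPolynomial ι ℝ →ₐ[ℝ] ℝ)
    (MvPolynomial.X r) ((hermite m).map (algebraMap ℤ ℝ))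
  rw [MvPolynomial.aeval_X, aeval_map_algebraMap] at h
  rw [Hval, h, hermiteVar, MvPolynomial.aeval_eq_eval]

lemma hermiteVar_zero (r : ι) : hermiteVar r 0 = 1 := by
  simp [hermiteVar]

lemma pderiv_hermiteVar_self (r : ι) (m : ℕ) :
    MvPolynomial.pderiv r (hermiteVar r m) = m * hermiteVar r (m - 1) := by
  rw [hermiteVar, Derivation.map_aeval, derivative_map, derivative_hermite]
  simp [hermiteVar]

lemma pderiv_hermiteVar_of_ne {r s : ι} (h : s ≠ r) (m : ℕ) :
    MvPolynomial.pderiv s (hermiteVar r m) = 0 := by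
  rw [hermiteVar, Derivation.map_aeval, MvPolynomial.pderiv_X_of_ne h.symm, smul_zero]

lemma hermiteVar_succ (r : ι) (m : ℕ) :
    hermiteVar r (m + 1) =
      MvPolynomial.X r * hermiteVar r m - MvPolynomial.pderiv r (hermiteVar r m) := by
  rw [pderiv_hermiteVar_self]
  simp only [hermiteVar, hermite_succ, derivative_hermite, Polynomial.map_sub,
    Polynomial.map_mul, map_X, Polynomial.map_natCast, map_sub, map_mul, aeval_X, map_natCast]

lemma pderiv_prod_eq_zero (s : Finset ι) (f : ι → MvPolynomial ι ℝ) (j : ι)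
    (h : ∀ r ∈ s, MvPolynomial.pderiv j (f r) = 0) :
    MvPolynomial.pderiv j (∏ r ∈ s, f r) = 0 := by
  classical
  induction s using Finset.induction_on with
  | empty => simp
  | insert a s ha ih =>
    rw [Finset.prod_insert ha, MvPolynomial.pderiv_mul, h a (Finset.mem_insert_self a s),
      ih fun r hr => h r (Finset.mem_insert_of_mem hr)]
    simp

variable [Fintype ι] [DecidableEq ι]

/-- The product of Hermite polynomials of degrees `q r` in the variables `r`. -/
def hermiteProd (q : ι → ℕ) : MvPolynomial ι ℝ := ∏ r, hermiteVar r (q r)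

lemma hermiteProd_eq_mul_erase (q : ι → ℕ) (j : ι) :
    hermiteProd q = hermiteVar j (q j) * ∏ r ∈ Finset.univ.erase j, hermiteVar r (q r) :=
  (Finset.mul_prod_erase _ _ (Finset.mem_univ j)).symm

lemma pderiv_hermiteProd_eq_mul_erase (q : ι → ℕ) (j : ι) :
    MvPolynomial.pderiv j (hermiteProd q) = MvPolynomial.pderiv j (hermiteVar j (q j)) *
      ∏ r ∈ Finset.univ.erase j, hermiteVar r (q r) := by
  rw [hermiteProd_eq_mul_erase q j, MvPolynomial.pderiv_mul, pderiv_prod_eq_zero]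
  · simp
  · exact fun r hr => pderiv_hermiteVar_of_ne (Finset.ne_of_mem_erase hr).symm _

lemma pderiv_hermiteProd (q : ι → ℕ) (j : ι) :
    MvPolynomial.pderiv j (hermiteProd q) =
      (q j : MvPolynomial ι ℝ) * hermiteProd (q - Pi.single j 1) := by
  rw [pderiv_hermiteProd_eq_mul_erase, hermiteProd_eq_mul_erase (q - Pi.single j 1) j,
    pderiv_hermiteVar_self, mul_assoc]
  congr 2
  · simp
  · refine Finset.prod_congr rfl fun r hr => ?_
    simp [Finset.ne_of_mem_erase hr]

lemma hermiteProd_add_single (q : ι → ℕ) (i : ι) :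
    hermiteProd (q + Pi.single i 1) =
      MvPolynomial.X i * hermiteProd q - MvPolynomial.pderiv i (hermiteProd q) := by
  rw [pderiv_hermiteProd_eq_mul_erase, hermiteProd_eq_mul_erase q i,
    hermiteProd_eq_mul_erase (q + Pi.single i 1) i, ← mul_assoc, ← sub_mul, ← hermiteVar_succ]
  congr 1
  · simp
  · refine Finset.prod_congr rfl fun r hr => ?_
    simp [Finset.ne_of_mem_erase hr]

end Hermite

/-- The diagram formula for a vector with a Gaussian moment generating function. -/
lemma integral_hermiteProd {n : ℕ} {Ω : Type*} {mΩ : MeasurableSpace Ω} {μ : Measure Ω}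
    {Z : Fin n → Ω → ℝ} (hZ : ∀ i, AEMeasurable (Z i) μ)
    (hexp : ∀ t : Fin n → ℝ, Integrable (fun ω => Real.exp (∑ i, t i * Z i ω)) μ)
    {S : Fin n → Fin n → ℝ} (hS : ∀ i j, S i j = S j i) (hdiag : ∀ i, S i i = 1)
    (hmgf : ∀ t : Fin n → ℝ, ∫ ω, Real.exp (∑ i, t i * Z i ω) ∂μ =
      Real.exp ((∑ i, ∑ j, t i * t j * S i j) / 2)) (q : Fin n → ℕ) :
    ∫ ω, MvPolynomial.eval (fun i => Z i ω) (hermiteProd q) ∂μ = diagramSum S q := by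
  have hint : ∀ p : MvPolynomial (Fin n) ℝ,
      Integrable (fun ω => MvPolynomial.eval (fun i => Z i ω) p) μ := fun p => by
    simpa using integrable_eval_mul_exp hZ hexp p 0
  have hstein : ∀ i, ∀ p : MvPolynomial (Fin n) ℝ,
      ∫ ω, MvPolynomial.eval (fun i => Z i ω) (MvPolynomial.X i * p) ∂μ =
        ∑ j, S i j * ∫ ω, MvPolynomial.eval (fun i => Z i ω) (MvPolynomial.pderiv j p) ∂μ :=
    fun i p => by simpa using integral_X_mul_eval_mul_exp hZ hexp hS hmgf i p 0
  induction hN : ∑ r, q r using Nat.strong_induction_on generalizing q with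
  | _ N ih =>
    subst hN
    by_cases h0 : q = 0
    · subst h0
      have h1 := hmgf 0
      simp only [Pi.zero_apply, zero_mul, Finset.sum_const_zero, Real.exp_zero, zero_div] at h1
      simpa [hermiteProd, hermiteVar_zero, diagramSum_zero] using h1
    · obtain ⟨i, hi⟩ := Function.ne_iff.mp h0
      obtain ⟨q, rfl⟩ : ∃ q' : Fin n → ℕ, q = q' + Pi.single i 1 :=
        ⟨_, (sub_single_add_single hi).symm⟩
      rw [hermiteProd_add_single, diagramSum_add_single hS]
      simp only [map_sub]
      rw [integral_sub (hint _) (hint _), hstein, ← Finset.add_sum_erase _ _ (Finset.mem_univ i),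
        hdiag, one_mul, add_sub_cancel_left]
      refine Finset.sum_congr rfl fun j _ => ?_
      rw [pderiv_hermiteProd]
      simp only [map_mul, map_natCast, integral_const_mul]
      by_cases hj : q j = 0
      · simp [hj]
      · rw [ih _ _ _ rfl]
        refine Finset.sum_lt_sum (fun r _ => ?_) ⟨i, Finset.mem_univ i, ?_⟩
        · simp only [Pi.sub_apply, Pi.add_apply]
          omega
        · simp only [Pi.sub_apply, Pi.add_apply, Pi.single_eq_same]
          omega

/-- Diagram formula: for a centered Gaussian vector `(Z₁,…,Zₙ)` with unit
variances, `E[∏ H_{q_r}(Z_r)] = ∏ q_r! · Σ_{κ ∈ A} ∏_{i<j} E[Z_i Z_j]^{k_ij}/k_ij!`.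
The Gaussian property is expressed by requiring every linear combination of the
`Z_i` to have the appropriate centered Gaussian law. -/
theorem stmt_5 (n : ℕ) (hn : 2 ≤ n)
    (Ω : Type) [MeasureSpace Ω] [IsProbabilityMeasure (volume : Measure Ω)]
    (Z : Fin n → Ω → ℝ) (Cov : Fin n → Fin n → ℝ)
    (hCov : ∀ i j, Cov i j = ∫ ω, Z i ω * Z j ω)
    (hGauss : ∀ a : Fin n → ℝ,
      Measure.map (fun ω => ∑ i, a i * Z i ω) volume =
        gaussianReal 0 (Real.toNNReal (∑ i, ∑ j, a i * a j * Cov i j)))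
    (hvar : ∀ i, Cov i i = 1)
    (q : Fin n → ℕ) :
    (∫ ω, ∏ r, Hval (q r) (Z r ω)) =
      (∏ r, (Nat.factorial (q r) : ℝ)) *
        ∑' κ : {k : Fin n → Fin n → ℕ // memA q k},
          ∏ p ∈ Finset.univ.filter (fun p : Fin n × Fin n => p.1 < p.2),
            Cov p.1 p.2 ^ (κ.1 p.1 p.2) / (Nat.factorial (κ.1 p.1 p.2) : ℝ) := by
  have hmeas : ∀ a : Fin n → ℝ, AEMeasurable (fun ω => ∑ i, a i * Z i ω) volume := fun a =>
    AEMeasurable.of_map_ne_zero (by rw [hGauss a]; exact IsProbabilityMeasure.ne_zero _)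
  have hZ : ∀ i, AEMeasurable (Z i) volume := fun i => by
    simpa [Pi.single_apply] using hmeas (Pi.single i 1)
  have hexp : ∀ t : Fin n → ℝ, Integrable (fun ω => Real.exp (∑ i, t i * Z i ω)) := fun t => by
    have h := integrable_exp_mul_gaussianReal (μ := 0)
      (v := Real.toNNReal (∑ i, ∑ j, t i * t j * Cov i j)) 1
    rw [← hGauss t] at h
    simpa [Function.comp_def] using h.comp_aemeasurable (hmeas t)
  have hprod : ∀ i j, Integrable (fun ω => Z i ω * Z j ω) := fun i j => by
    refine (integrable_eval_mul_exp hZ hexp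
      (MvPolynomial.X i * MvPolynomial.X j) 0).congr (ae_of_all _ fun ω => ?_)
    simp
  have hnonneg : ∀ t : Fin n → ℝ, 0 ≤ ∑ i, ∑ j, t i * t j * Cov i j := fun t => by
    have hterm : ∀ i j, Integrable (fun ω => t i * Z i ω * (t j * Z j ω)) := fun i j => by
      convert (hprod i j).const_mul (t i * t j) using 2
      ring
    have h : ∑ i, ∑ j, t i * t j * Cov i j = ∫ ω, (∑ i, t i * Z i ω) ^ 2 := by
      simp only [hCov, ← integral_const_mul]
      rw [eq_comm]
      simp only [sq, Finset.sum_mul_sum]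
      rw [integral_finsetSum _ fun i _ => integrable_finsetSum _ fun j _ => hterm i j]
      refine Finset.sum_congr rfl fun i _ => ?_
      rw [integral_finsetSum _ fun j _ => hterm i j]
      refine Finset.sum_congr rfl fun j _ => ?_
      congr 1
      ext ω
      ring
    rw [h]
    exact integral_nonneg fun ω => sq_nonneg _
  have hmgf : ∀ t : Fin n → ℝ, ∫ ω, Real.exp (∑ i, t i * Z i ω) =
      Real.exp ((∑ i, ∑ j, t i * t j * Cov i j) / 2) := fun t => by
    have h := mgf_gaussianReal (hGauss t) 1
    simpa [mgf, Real.coe_toNNReal _ (hnonneg t)] using h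
  have hS : ∀ i j, Cov i j = Cov j i := fun i j => by
    simp only [hCov, mul_comm]
  have key := integral_hermiteProd hZ hexp hS hvar hmgf q
  simp only [hermiteProd, map_prod, eval_hermiteVar] at key
  rw [key, diagramSum, ← tsum_memA]
  rfl
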